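/- The canonical Poisson brackets {I₀₁, I₂₃}, {I₀₂, I₁₃} and {I₀₃, I₁₂} all vanish at every point of D. -/

import Mathlib

namespace Paper
noncomputable section

/-- The κ-dependent cosine Cκ(x) = ∑ (−κ)^l x^{2l}/(2l)!. -/
def Ck (κ x : ℝ) : ℝ := ∑' l : ℕ, (-κ) ^ l * x ^ (2 * l) / (Nat.factorial (2 * l) : ℝ)

/-- The κ-dependent sine Sκ(x) = ∑ (−κ)^l x^{2l+1}/(2l+1)!. -/
def Sk (κ x : ℝ) : ℝ := ∑' l : ℕ, (-κ) ^ l * x ^ (2 * l + 1) / (Nat.factorial (2 * l + 1) : ℝ)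

/-- The κ-dependent tangent Tκ(x) = Sκ(x)/Cκ(x). -/
def Tk (κ x : ℝ) : ℝ := Sk κ x / Ck κ x

/-- Phase space ℝ³ × ℝ³ ≃ ℝ⁶ with canonical coordinates
`(r, θ, φ, p_r, p_θ, p_φ) = (x 0, x 1, x 2, x 3, x 4, x 5)`. -/
abbrev Pt := Fin 6 → ℝ

/-- Partial derivative in the i-th coordinate direction. -/
def pd (f : Pt → ℝ) (i : Fin 6) (x : Pt) : ℝ := fderiv ℝ f x (Pi.single i 1)

/-- Canonical Poisson bracket {f,g} = ∑_{q} (∂f/∂q ∂g/∂p_q − ∂g/∂q ∂f/∂p_q). -/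
def pb (f g : Pt → ℝ) (x : Pt) : ℝ :=
  ∑ i : Fin 3,
    (pd f ⟨i.1, by omega⟩ x * pd g ⟨i.1 + 3, by omega⟩ x
      - pd g ⟨i.1, by omega⟩ x * pd f ⟨i.1 + 3, by omega⟩ x)

/-- Gradient of a function on phase space, as a vector in ℝ⁶. -/
def grad (f : Pt → ℝ) (x : Pt) : Fin 6 → ℝ := fun i => pd f i x

/-- The open domain D where Sκ₁(r), Cκ₁(r), Sκ₂(θ), Cκ₂(θ), cos φ, sin φ are nonzero. -/
def D (κ₁ κ₂ : ℝ) : Set Pt :=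
  {x | Sk κ₁ (x 0) ≠ 0 ∧ Ck κ₁ (x 0) ≠ 0 ∧ Sk κ₂ (x 1) ≠ 0 ∧ Ck κ₂ (x 1) ≠ 0 ∧
       Real.cos (x 2) ≠ 0 ∧ Real.sin (x 2) ≠ 0}

/-- J₀₁ = Cκ₂(θ)p_r − (Sκ₂(θ)/Tκ₁(r))p_θ. -/
def J01 (κ₁ κ₂ : ℝ) (x : Pt) : ℝ :=
  Ck κ₂ (x 1) * x 3 - (Sk κ₂ (x 1) / Tk κ₁ (x 0)) * x 4

/-- J₀₂. -/
def J02 (κ₁ κ₂ : ℝ) (x : Pt) : ℝ :=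
  κ₂ * Sk κ₂ (x 1) * Real.cos (x 2) * x 3
    + (Ck κ₂ (x 1) * Real.cos (x 2) / Tk κ₁ (x 0)) * x 4
    - (Real.sin (x 2) / (Tk κ₁ (x 0) * Sk κ₂ (x 1))) * x 5

/-- J₀₃. -/
def J03 (κ₁ κ₂ : ℝ) (x : Pt) : ℝ :=
  κ₂ * Sk κ₂ (x 1) * Real.sin (x 2) * x 3
    + (Ck κ₂ (x 1) * Real.sin (x 2) / Tk κ₁ (x 0)) * x 4
    + (Real.cos (x 2) / (Tk κ₁ (x 0) * Sk κ₂ (x 1))) * x 5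

/-- J₁₂ = cos φ·p_θ − (sin φ/Tκ₂(θ))p_φ. -/
def J12 (κ₂ : ℝ) (x : Pt) : ℝ :=
  Real.cos (x 2) * x 4 - (Real.sin (x 2) / Tk κ₂ (x 1)) * x 5

/-- J₁₃ = sin φ·p_θ + (cos φ/Tκ₂(θ))p_φ. -/
def J13 (κ₂ : ℝ) (x : Pt) : ℝ :=
  Real.sin (x 2) * x 4 + (Real.cos (x 2) / Tk κ₂ (x 1)) * x 5

/-- J₂₃ = p_φ. -/
def J23 (x : Pt) : ℝ := x 5

/-- Kinetic energy T. -/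
def Tkin (κ₁ κ₂ : ℝ) (x : Pt) : ℝ :=
  (1 / 2) * ((x 3) ^ 2 + (x 4) ^ 2 / (κ₂ * Sk κ₁ (x 0) ^ 2)
    + (x 5) ^ 2 / (κ₂ * Sk κ₁ (x 0) ^ 2 * Sk κ₂ (x 1) ^ 2))

/-- The superintegrable potential U with arbitrary radial function F. -/
def U (κ₁ κ₂ : ℝ) (F : ℝ → ℝ) (β₁ β₂ β₃ : ℝ) (x : Pt) : ℝ :=
  F (x 0) + (1 / Sk κ₁ (x 0) ^ 2) *
    (β₁ / Ck κ₂ (x 1) ^ 2 + β₂ / (Sk κ₂ (x 1) ^ 2 * Real.cos (x 2) ^ 2)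
      + β₃ / (Sk κ₂ (x 1) ^ 2 * Real.sin (x 2) ^ 2))

/-- Integral I₁₂. -/
def I12 (κ₂ β₁ β₂ : ℝ) (x : Pt) : ℝ :=
  (Real.cos (x 2) * x 4 - (Real.sin (x 2) / Tk κ₂ (x 1)) * x 5) ^ 2
    + 2 * β₁ * κ₂ ^ 2 * Tk κ₂ (x 1) ^ 2 * Real.cos (x 2) ^ 2
    + 2 * β₂ * κ₂ / (Tk κ₂ (x 1) ^ 2 * Real.cos (x 2) ^ 2)

/-- Integral I₁₃. -/
def I13 (κ₂ β₁ β₃ : ℝ) (x : Pt) : ℝ :=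
  (Real.sin (x 2) * x 4 + (Real.cos (x 2) / Tk κ₂ (x 1)) * x 5) ^ 2
    + 2 * β₁ * κ₂ ^ 2 * Tk κ₂ (x 1) ^ 2 * Real.sin (x 2) ^ 2
    + 2 * β₃ * κ₂ / (Tk κ₂ (x 1) ^ 2 * Real.sin (x 2) ^ 2)

/-- Integral I₂₃. -/
def I23 (κ₂ β₂ β₃ : ℝ) (x : Pt) : ℝ :=
  (x 5) ^ 2 + 2 * β₂ * κ₂ * Real.tan (x 2) ^ 2 + 2 * β₃ * κ₂ / Real.tan (x 2) ^ 2

/-- Integral I₁₂₃. -/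
def I123 (κ₂ β₁ β₂ β₃ : ℝ) (x : Pt) : ℝ :=
  (x 4) ^ 2 + (x 5) ^ 2 / Sk κ₂ (x 1) ^ 2 + 2 * β₁ * κ₂ / Ck κ₂ (x 1) ^ 2
    + 2 * β₂ * κ₂ / (Sk κ₂ (x 1) ^ 2 * Real.cos (x 2) ^ 2)
    + 2 * β₃ * κ₂ / (Sk κ₂ (x 1) ^ 2 * Real.sin (x 2) ^ 2)

/-- The Smorodinsky–Winternitz Hamiltonian H^SW. -/
def HSW (κ₁ κ₂ β₀ β₁ β₂ β₃ : ℝ) (x : Pt) : ℝ :=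
  Tkin κ₁ κ₂ x + β₀ * Tk κ₁ (x 0) ^ 2 + (1 / Sk κ₁ (x 0) ^ 2) *
    (β₁ / Ck κ₂ (x 1) ^ 2 + β₂ / (Sk κ₂ (x 1) ^ 2 * Real.cos (x 2) ^ 2)
      + β₃ / (Sk κ₂ (x 1) ^ 2 * Real.sin (x 2) ^ 2))

/-- Integral I₀₁ of H^SW. -/
def I01 (κ₁ κ₂ β₀ β₁ : ℝ) (x : Pt) : ℝ :=
  J01 κ₁ κ₂ x ^ 2 + 2 * β₀ * Tk κ₁ (x 0) ^ 2 * Ck κ₂ (x 1) ^ 2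
    + 2 * β₁ / (Tk κ₁ (x 0) ^ 2 * Ck κ₂ (x 1) ^ 2)

/-- Integral I₀₂ of H^SW. -/
def I02 (κ₁ κ₂ β₀ β₂ : ℝ) (x : Pt) : ℝ :=
  J02 κ₁ κ₂ x ^ 2 + 2 * β₀ * κ₂ ^ 2 * Tk κ₁ (x 0) ^ 2 * Sk κ₂ (x 1) ^ 2 * Real.cos (x 2) ^ 2
    + 2 * β₂ * κ₂ / (Tk κ₁ (x 0) ^ 2 * Sk κ₂ (x 1) ^ 2 * Real.cos (x 2) ^ 2)

/-- Integral I₀₃ of H^SW. -/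
def I03 (κ₁ κ₂ β₀ β₃ : ℝ) (x : Pt) : ℝ :=
  J03 κ₁ κ₂ x ^ 2 + 2 * β₀ * κ₂ ^ 2 * Tk κ₁ (x 0) ^ 2 * Sk κ₂ (x 1) ^ 2 * Real.sin (x 2) ^ 2
    + 2 * β₃ * κ₂ / (Tk κ₁ (x 0) ^ 2 * Sk κ₂ (x 1) ^ 2 * Real.sin (x 2) ^ 2)

/-- Generalized Kepler–Coulomb Hamiltonian H^GKC₁ = T + U^GKC₁. -/
def HGKC1 (κ₁ κ₂ k β₂ β₃ : ℝ) (x : Pt) : ℝ :=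
  Tkin κ₁ κ₂ x - k / Tk κ₁ (x 0)
    + (1 / (Sk κ₁ (x 0) ^ 2 * Sk κ₂ (x 1) ^ 2)) *
        (β₂ / Real.cos (x 2) ^ 2 + β₃ / Real.sin (x 2) ^ 2)

/-- Generalized Kepler–Coulomb Hamiltonian H^GKC₂ = T + U^GKC₂. -/
def HGKC2 (κ₁ κ₂ k β₁ β₃ : ℝ) (x : Pt) : ℝ :=
  Tkin κ₁ κ₂ x - k / Tk κ₁ (x 0)
    + (1 / Sk κ₁ (x 0) ^ 2) *
        (β₁ / Ck κ₂ (x 1) ^ 2 + β₃ / (Sk κ₂ (x 1) ^ 2 * Real.sin (x 2) ^ 2))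

/-- Generalized Kepler–Coulomb Hamiltonian H^GKC₃ = T + U^GKC₃. -/
def HGKC3 (κ₁ κ₂ k β₁ β₂ : ℝ) (x : Pt) : ℝ :=
  Tkin κ₁ κ₂ x - k / Tk κ₁ (x 0)
    + (1 / Sk κ₁ (x 0) ^ 2) *
        (β₁ / Ck κ₂ (x 1) ^ 2 + β₂ / (Sk κ₂ (x 1) ^ 2 * Real.cos (x 2) ^ 2))

/-- The function L₁. -/
def L1 (κ₁ κ₂ k β₂ β₃ : ℝ) (x : Pt) : ℝ :=
  -(J02 κ₁ κ₂ x * J12 κ₂ x) - J03 κ₁ κ₂ x * J13 κ₂ x + k * κ₂ * Ck κ₂ (x 1)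
    - (2 * κ₂ * Ck κ₂ (x 1) / (Tk κ₁ (x 0) * Sk κ₂ (x 1) ^ 2)) *
        (β₂ / Real.cos (x 2) ^ 2 + β₃ / Real.sin (x 2) ^ 2)

/-- The function L₂. -/
def L2 (κ₁ κ₂ k β₁ β₃ : ℝ) (x : Pt) : ℝ :=
  J01 κ₁ κ₂ x * J12 κ₂ x - J03 κ₁ κ₂ x * J23 x + k * κ₂ * Sk κ₂ (x 1) * Real.cos (x 2)
    - (2 * κ₂ * Real.cos (x 2) / Tk κ₁ (x 0)) *
        (β₁ * Sk κ₂ (x 1) / Ck κ₂ (x 1) ^ 2 + β₃ / (Sk κ₂ (x 1) * Real.sin (x 2) ^ 2))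

/-- The function L₃. -/
def L3 (κ₁ κ₂ k β₁ β₂ : ℝ) (x : Pt) : ℝ :=
  J01 κ₁ κ₂ x * J13 κ₂ x + J02 κ₁ κ₂ x * J23 x + k * κ₂ * Sk κ₂ (x 1) * Real.sin (x 2)
    - (2 * κ₂ * Real.sin (x 2) / Tk κ₁ (x 0)) *
        (β₁ * Sk κ₂ (x 1) / Ck κ₂ (x 1) ^ 2 + β₂ / (Sk κ₂ (x 1) * Real.cos (x 2) ^ 2))

section TrigFunctions

theorem Ck_zero (x : ℝ) : Ck 0 x = 1 := by
  rw [Ck, tsum_eq_single 0]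
  · simp
  · intro l hl
    simp [hl]

theorem Sk_zero (x : ℝ) : Sk 0 x = x := by
  rw [Sk, tsum_eq_single 0]
  · simp
  · intro l hl
    simp [hl]

theorem ofReal_Ck {κ : ℝ} {w : ℂ} (hw : w ^ 2 = κ) (x : ℝ) :
    (Ck κ x : ℂ) = Complex.cos (w * x) := by
  rw [Ck, Complex.ofReal_tsum, ← (Complex.hasSum_cos (w * x)).tsum_eq]
  refine tsum_congr fun l => ?_
  push_cast
  rw [mul_pow, pow_mul w, hw, neg_pow]
  ring

theorem ofReal_Sk {κ : ℝ} {w : ℂ} (hw : w ^ 2 = κ) (x : ℝ) :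
    w * (Sk κ x : ℂ) = Complex.sin (w * x) := by
  rw [Sk, Complex.ofReal_tsum, ← (Complex.hasSum_sin (w * x)).tsum_eq, ← tsum_mul_left]
  refine tsum_congr fun l => ?_
  push_cast
  rw [mul_pow, pow_succ w, pow_mul w, hw, neg_pow]
  ring

theorem exists_sq_eq_ofReal (κ : ℝ) : ∃ w : ℂ, w ^ 2 = κ :=
  IsAlgClosed.exists_pow_nat_eq _ two_pos

theorem Ck_sq_add (κ x : ℝ) : Ck κ x ^ 2 + κ * Sk κ x ^ 2 = 1 := by
  obtain ⟨w, hw⟩ := exists_sq_eq_ofReal κ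
  have h := Complex.cos_sq_add_sin_sq (w * x)
  rw [← ofReal_Ck hw, ← ofReal_Sk hw, mul_pow, hw] at h
  exact_mod_cast h

theorem hasDerivAt_Ck (κ x : ℝ) : HasDerivAt (Ck κ) (-κ * Sk κ x) x := by
  obtain ⟨w, hw⟩ := exists_sq_eq_ofReal κ
  have h : HasDerivAt (fun z : ℂ => Complex.cos (w * z)) ((-κ * Sk κ x : ℝ) : ℂ) (x : ℂ) := by
    refine ((hasDerivAt_id (x : ℂ)).const_mul w).ccos.congr_deriv ?_
    simp only [id, ← ofReal_Sk hw, Complex.ofReal_mul, Complex.ofReal_neg, ← hw]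
    ring
  have h' := h.real_of_complex
  simp only [← ofReal_Ck hw, Complex.ofReal_re] at h'
  exact h'

theorem hasDerivAt_Sk (κ x : ℝ) : HasDerivAt (Sk κ) (Ck κ x) x := by
  obtain ⟨w, hw⟩ := exists_sq_eq_ofReal κ
  rcases eq_or_ne w 0 with rfl | hw0
  · obtain rfl : κ = 0 := by simpa using hw.symm
    rw [Ck_zero, funext Sk_zero]
    exact hasDerivAt_id x
  · have h : HasDerivAt (fun z : ℂ => Complex.sin (w * z) / w) (Ck κ x : ℂ) (x : ℂ) := by
      refine (((hasDerivAt_id (x : ℂ)).const_mul w).csin.div_const w).congr_deriv ?_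
      simp only [id, ofReal_Ck hw]
      field_simp
    have h' := h.real_of_complex
    simp only [← ofReal_Sk hw, mul_div_cancel_left₀ _ hw0, Complex.ofReal_re] at h'
    exact h'

theorem hasDerivAt_Tk {κ x : ℝ} (hC : Ck κ x ≠ 0) :
    HasDerivAt (Tk κ) ((Ck κ x ^ 2)⁻¹) x := by
  refine ((hasDerivAt_Sk κ x).div (hasDerivAt_Ck κ x) hC).congr_deriv ?_
  rw [div_eq_inv_mul]
  linear_combination ((Ck κ x ^ 2)⁻¹) * Ck_sq_add κ x

end TrigFunctions

section PartialDerivatives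

variable {f g : Pt → ℝ} {x : Pt}

theorem pd_add (hf : DifferentiableAt ℝ f x) (hg : DifferentiableAt ℝ g x) (i : Fin 6) :
    pd (fun y => f y + g y) i x = pd f i x + pd g i x := by
  simp [pd, fderiv_fun_add hf hg]

theorem pd_sub (hf : DifferentiableAt ℝ f x) (hg : DifferentiableAt ℝ g x) (i : Fin 6) :
    pd (fun y => f y - g y) i x = pd f i x - pd g i x := by
  simp [pd, fderiv_fun_sub hf hg]

theorem pd_mul (hf : DifferentiableAt ℝ f x) (hg : DifferentiableAt ℝ g x) (i : Fin 6) :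
    pd (fun y => f y * g y) i x = pd f i x * g x + f x * pd g i x := by
  simp [pd, fderiv_fun_mul hf hg]
  ring

theorem pd_const (c : ℝ) (i : Fin 6) : pd (fun _ => c) i x = 0 := by
  simp [pd]

theorem pd_comp {h : ℝ → ℝ} {h' : ℝ} (hh : HasDerivAt h h' (f x))
    (hf : DifferentiableAt ℝ f x) (i : Fin 6) :
    pd (fun y => h (f y)) i x = h' * pd f i x := by
  have := (hh.comp_hasFDerivAt x hf.hasFDerivAt).fderiv
  simp only [Function.comp_def] at this
  simp [pd, this]

theorem pd_coord (i j : Fin 6) : pd (fun y => y j) i x = if j = i then 1 else 0 := by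
  have h : HasFDerivAt (fun y : Pt => y j) (ContinuousLinearMap.proj (R := ℝ) j) x :=
    hasFDerivAt_apply j x
  simp [pd, h.fderiv, Pi.single_apply]

theorem differentiableAt_comp_coord {h : ℝ → ℝ} {h' : ℝ} {j : Fin 6}
    (hh : HasDerivAt h h' (x j)) : DifferentiableAt ℝ (fun y : Pt => h (y j)) x :=
  DifferentiableAt.fun_comp' (f := fun y : Pt => y j) x hh.differentiableAt
    (differentiableAt_apply j x)

theorem pd_comp_coord {h : ℝ → ℝ} {h' : ℝ} {j : Fin 6} (hh : HasDerivAt h h' (x j))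
    (i : Fin 6) : pd (fun y => h (y j)) i x = if j = i then h' else 0 := by
  rw [pd_comp (f := fun y => y j) hh (differentiableAt_apply j x), pd_coord]
  simp

theorem pb_eq (f g : Pt → ℝ) (x : Pt) :
    pb f g x = (pd f 0 x * pd g 3 x - pd g 0 x * pd f 3 x)
      + (pd f 1 x * pd g 4 x - pd g 1 x * pd f 4 x)
      + (pd f 2 x * pd g 5 x - pd g 2 x * pd f 5 x) := by
  rw [pb, Fin.sum_univ_three]
  rfl

theorem pd_sq_add_potential {J u : Pt → ℝ} (hJ : DifferentiableAt ℝ J x)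
    (hu : DifferentiableAt ℝ u x) (hu0 : u x ≠ 0) (a b : ℝ) (i : Fin 6) :
    pd (fun y => J y ^ 2 + (a * u y ^ 2 + b / u y ^ 2)) i x
      = 2 * J x * pd J i x + (2 * a * u x - 2 * b / u x ^ 3) * pd u i x := by
  have hV : HasDerivAt (fun t : ℝ => a * t ^ 2 + b / t ^ 2)
      (2 * a * u x - 2 * b / u x ^ 3) (u x) := by
    refine (((hasDerivAt_pow 2 (u x)).const_mul a).add
      ((hasDerivAt_const (u x) b).div (hasDerivAt_pow 2 (u x)) (pow_ne_zero 2 hu0))).congr_deriv ?_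
    field_simp
    push_cast
    ring
  have hsq : HasDerivAt (fun t : ℝ => t ^ 2) (2 * J x) (J x) := by
    simpa using hasDerivAt_pow 2 (J x)
  rw [pd_add (f := fun y => J y ^ 2) (g := fun y => a * u y ^ 2 + b / u y ^ 2) (hJ.pow 2)
    (hV.differentiableAt.comp x hu), pd_comp hsq hJ, pd_comp hV hu]

theorem pb_sq_add_potential_eq_zero {J K u v : Pt → ℝ}
    (hJ : DifferentiableAt ℝ J x) (hK : DifferentiableAt ℝ K x)
    (hu : DifferentiableAt ℝ u x) (hv : DifferentiableAt ℝ v x)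
    (hu0 : u x ≠ 0) (hv0 : v x ≠ 0)
    (hJK : pb J K x = 0) (hJv : pb J v x = 0) (huK : pb u K x = 0) (huv : pb u v x = 0)
    (a b c d : ℝ) :
    pb (fun y => J y ^ 2 + (a * u y ^ 2 + b / u y ^ 2))
      (fun y => K y ^ 2 + (c * v y ^ 2 + d / v y ^ 2)) x = 0 := by
  rw [pb_eq] at hJK hJv huK huv ⊢
  simp only [pd_sq_add_potential hJ hu hu0, pd_sq_add_potential hK hv hv0]
  linear_combination 4 * J x * K x * hJK
    + 2 * J x * (2 * c * v x - 2 * d / v x ^ 3) * hJv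
    + 2 * K x * (2 * a * u x - 2 * b / u x ^ 3) * huK
    + (2 * a * u x - 2 * b / u x ^ 3) * (2 * c * v x - 2 * d / v x ^ 3) * huv

end PartialDerivatives

set_option maxHeartbeats 4000000 in
/-- the Poisson brackets {I₀₁,I₂₃}, {I₀₂,I₁₃}, {I₀₃,I₁₂} all
vanish at every point of D. -/
theorem cross_brackets_vanish (κ₁ κ₂ : ℝ) (hκ₂ : κ₂ ≠ 0) (β₀ β₁ β₂ β₃ : ℝ) :
    ∀ x ∈ D κ₁ κ₂,
      pb (I01 κ₁ κ₂ β₀ β₁) (I23 κ₂ β₂ β₃) x = 0 ∧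
      pb (I02 κ₁ κ₂ β₀ β₂) (I13 κ₂ β₁ β₃) x = 0 ∧
      pb (I03 κ₁ κ₂ β₀ β₃) (I12 κ₂ β₁ β₂) x = 0 := by
  rintro x ⟨hS₁, hC₁, hS₂, hC₂, hcos, hsin⟩
  have hT₁ : Tk κ₁ (x 0) ≠ 0 := div_ne_zero hS₁ hC₁
  have hT₂ : Tk κ₂ (x 1) ≠ 0 := div_ne_zero hS₂ hC₂
  have htan : Real.tan (x 2) ≠ 0 := by
    rw [Real.tan_eq_sin_div_cos]
    exact div_ne_zero hsin hcos
  have dS := hasDerivAt_Sk κ₂ (x 1)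
  have dC := hasDerivAt_Ck κ₂ (x 1)
  have dT := hasDerivAt_Tk hC₂
  have dT₁ := hasDerivAt_Tk hC₁
  have dTi := dT.fun_inv hT₂
  have dT₁i := dT₁.fun_inv hT₁
  have dSi := dS.fun_inv hS₂
  have dcos := Real.hasDerivAt_cos (x 2)
  have dsin := Real.hasDerivAt_sin (x 2)
  have dtan := Real.hasDerivAt_tan hcos
  have cS : DifferentiableAt ℝ (fun y : Pt => Sk κ₂ (y 1)) x :=
    differentiableAt_comp_coord dS
  have cC : DifferentiableAt ℝ (fun y : Pt => Ck κ₂ (y 1)) x :=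
    differentiableAt_comp_coord dC
  have cT : DifferentiableAt ℝ (fun y : Pt => Tk κ₂ (y 1)) x :=
    differentiableAt_comp_coord dT
  have cT₁ : DifferentiableAt ℝ (fun y : Pt => Tk κ₁ (y 0)) x :=
    differentiableAt_comp_coord dT₁
  have ctan : DifferentiableAt ℝ (fun y : Pt => Real.tan (y 2)) x :=
    differentiableAt_comp_coord dtan
  have cTi : DifferentiableAt ℝ (fun y : Pt => (Tk κ₂ (y 1))⁻¹) x := cT.fun_inv hT₂
  have cT₁i : DifferentiableAt ℝ (fun y : Pt => (Tk κ₁ (y 0))⁻¹) x := cT₁.fun_inv hT₁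
  have cSi : DifferentiableAt ℝ (fun y : Pt => (Sk κ₂ (y 1))⁻¹) x := cS.fun_inv hS₂
  have eJ01 : J01 κ₁ κ₂ = fun y => Ck κ₂ (y 1) * y 3
      - (Sk κ₂ (y 1) * (Tk κ₁ (y 0))⁻¹) * y 4 := rfl
  have eJ02 : J02 κ₁ κ₂ = fun y => κ₂ * Sk κ₂ (y 1) * Real.cos (y 2) * y 3
      + (Ck κ₂ (y 1) * Real.cos (y 2) * (Tk κ₁ (y 0))⁻¹) * y 4
      - (Real.sin (y 2) * ((Tk κ₁ (y 0))⁻¹ * (Sk κ₂ (y 1))⁻¹)) * y 5 := by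
    ext y
    rw [J02, div_eq_mul_inv, div_eq_mul_inv, mul_inv]
  have eJ03 : J03 κ₁ κ₂ = fun y => κ₂ * Sk κ₂ (y 1) * Real.sin (y 2) * y 3
      + (Ck κ₂ (y 1) * Real.sin (y 2) * (Tk κ₁ (y 0))⁻¹) * y 4
      + (Real.cos (y 2) * ((Tk κ₁ (y 0))⁻¹ * (Sk κ₂ (y 1))⁻¹)) * y 5 := by
    ext y
    rw [J03, div_eq_mul_inv, div_eq_mul_inv, mul_inv]
  have eJ12 : J12 κ₂ = fun y => Real.cos (y 2) * y 4
      - (Real.sin (y 2) * (Tk κ₂ (y 1))⁻¹) * y 5 := rfl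
  have eJ13 : J13 κ₂ = fun y => Real.sin (y 2) * y 4
      + (Real.cos (y 2) * (Tk κ₂ (y 1))⁻¹) * y 5 := rfl
  have hpyth := Ck_sq_add κ₂ (x 1)
  have htrig := Real.sin_sq_add_cos_sq (x 2)
  have hT : Tk κ₂ (x 1) = Sk κ₂ (x 1) / Ck κ₂ (x 1) := rfl
  have eI01 : I01 κ₁ κ₂ β₀ β₁ = fun y => J01 κ₁ κ₂ y ^ 2
      + (2 * β₀ * (Tk κ₁ (y 0) * Ck κ₂ (y 1)) ^ 2
        + 2 * β₁ / (Tk κ₁ (y 0) * Ck κ₂ (y 1)) ^ 2) := by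
    ext y; rw [I01]; ring
  have eI02 : I02 κ₁ κ₂ β₀ β₂ = fun y => J02 κ₁ κ₂ y ^ 2
      + (2 * β₀ * κ₂ ^ 2 * (Tk κ₁ (y 0) * Sk κ₂ (y 1) * Real.cos (y 2)) ^ 2
        + 2 * β₂ * κ₂ / (Tk κ₁ (y 0) * Sk κ₂ (y 1) * Real.cos (y 2)) ^ 2) := by
    ext y; rw [I02]; ring
  have eI03 : I03 κ₁ κ₂ β₀ β₃ = fun y => J03 κ₁ κ₂ y ^ 2
      + (2 * β₀ * κ₂ ^ 2 * (Tk κ₁ (y 0) * Sk κ₂ (y 1) * Real.sin (y 2)) ^ 2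
        + 2 * β₃ * κ₂ / (Tk κ₁ (y 0) * Sk κ₂ (y 1) * Real.sin (y 2)) ^ 2) := by
    ext y; rw [I03]; ring
  have eI12 : I12 κ₂ β₁ β₂ = fun y => J12 κ₂ y ^ 2
      + (2 * β₁ * κ₂ ^ 2 * (Tk κ₂ (y 1) * Real.cos (y 2)) ^ 2
        + 2 * β₂ * κ₂ / (Tk κ₂ (y 1) * Real.cos (y 2)) ^ 2) := by
    ext y; rw [I12, J12]; ring
  have eI13 : I13 κ₂ β₁ β₃ = fun y => J13 κ₂ y ^ 2
      + (2 * β₁ * κ₂ ^ 2 * (Tk κ₂ (y 1) * Real.sin (y 2)) ^ 2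
        + 2 * β₃ * κ₂ / (Tk κ₂ (y 1) * Real.sin (y 2)) ^ 2) := by
    ext y; rw [I13, J13]; ring
  have eI23 : I23 κ₂ β₂ β₃ = fun y => y 5 ^ 2
      + (2 * β₂ * κ₂ * Real.tan (y 2) ^ 2 + 2 * β₃ * κ₂ / Real.tan (y 2) ^ 2) := by
    ext y; rw [I23]; ring
  refine ⟨?_, ?_, ?_⟩
  · rw [eI01, eI23, eJ01]
    apply pb_sq_add_potential_eq_zero <;> try first | fun_prop | positivity
    all_goals
      simp (disch := fun_prop) only [pb_eq, pd_sub, pd_mul, pd_coord, pd_comp_coord dS,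
        pd_comp_coord dC, pd_comp_coord dT₁, pd_comp_coord dT₁i, pd_comp_coord dtan]
      simp
  · rw [eI02, eI13, eJ02, eJ13]
    apply pb_sq_add_potential_eq_zero <;> try first | fun_prop | positivity
    all_goals
      simp (disch := fun_prop) only [pb_eq, pd_add, pd_sub, pd_mul, pd_const, pd_coord,
        pd_comp_coord dS, pd_comp_coord dC, pd_comp_coord dT, pd_comp_coord dT₁,
        pd_comp_coord dTi, pd_comp_coord dT₁i, pd_comp_coord dSi, pd_comp_coord dcos,
        pd_comp_coord dsin]
      simp [hT]
    all_goals
      clear dS dC dT dT₁ dTi dT₁i dSi dcos dsin dtan cS cC cT cT₁ ctan cTi cT₁i cSi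
        eJ01 eJ02 eJ03 eJ12 eJ13 eI01 eI02 eI03 eI12 eI13 eI23
      try field_simp
      grind
  · rw [eI03, eI12, eJ03, eJ12]
    apply pb_sq_add_potential_eq_zero <;> try first | fun_prop | positivity
    all_goals
      simp (disch := fun_prop) only [pb_eq, pd_add, pd_sub, pd_mul, pd_const, pd_coord,
        pd_comp_coord dS, pd_comp_coord dC, pd_comp_coord dT, pd_comp_coord dT₁,
        pd_comp_coord dTi, pd_comp_coord dT₁i, pd_comp_coord dSi, pd_comp_coord dcos,
        pd_comp_coord dsin]
      simp [hT]
    all_goals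
      clear dS dC dT dT₁ dTi dT₁i dSi dcos dsin dtan cS cC cT cT₁ ctan cTi cT₁i cSi
        eJ01 eJ02 eJ03 eJ12 eJ13 eI01 eI02 eI03 eI12 eI13 eI23
      try field_simp
      grind

end
end Paper
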